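/- If p and q are acyclic MLL proof nets and p ⇒e q (parallel elimination of a family of evanescent cuts), then jd(q) ≤ (2·jd(p))^{ln(p)+1}. -/

import Mathlib

/- Formalization of untyped MLL proof nets with jumps, switching paths,
   and parallel cut elimination, following Chouquet & Vaux Auclair. -/

namespace MLLNets

attribute [local instance] Classical.propDecidable

/-- Trees of MLL nets: variables (axiom conclusions, paired by the involution
    `(n,b) ↦ (n,!b)`), labelled units `1_λ`, labelled counits `⊥_μ`, and
    n-ary connectives `⊗`, `⅋`. -/
inductive Tree : Type where
  | var : ℕ → Bool → Tree
  | unit : ℕ → Tree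
  | counit : ℕ → Tree
  | tens : List Tree → Tree
  | parr : List Tree → Tree

instance : Inhabited Tree := ⟨Tree.unit 0⟩

/-- Atoms: variables, unit labels, counit labels. -/
inductive Atom : Type where
  | var : ℕ → Bool → Atom
  | unit : ℕ → Atom
  | counit : ℕ → Atom

namespace Tree

/-- Number of subtrees of a tree. -/
def size : Tree → ℕ
  | var _ _ => 1
  | unit _ => 1
  | counit _ => 1
  | tens ts => 1 + (ts.attach.map (fun x => x.1.size)).sum
  | parr ts => 1 + (ts.attach.map (fun x => x.1.size)).sum
termination_by t => sizeOf t
decreasing_by all_goals (have h := List.sizeOf_lt_of_mem x.2; simp; omega)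

/-- The set of subtrees of a tree. -/
noncomputable def ST : Tree → Finset Tree
  | var n b => {var n b}
  | unit l => {unit l}
  | counit l => {counit l}
  | tens ts => insert (tens ts) ((ts.attach.map (fun x => x.1.ST)).foldr (· ∪ ·) ∅)
  | parr ts => insert (parr ts) ((ts.attach.map (fun x => x.1.ST)).foldr (· ∪ ·) ∅)
termination_by t => sizeOf t
decreasing_by all_goals (have h := List.sizeOf_lt_of_mem x.2; simp; omega)

/-- The multiset of atoms occurring in a tree. -/
def atoms : Tree → Multiset Atom
  | var n b => {Atom.var n b}
  | unit l => {Atom.unit l}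
  | counit l => {Atom.counit l}
  | tens ts => (ts.attach.map (fun x => x.1.atoms)).sum
  | parr ts => (ts.attach.map (fun x => x.1.atoms)).sum
termination_by t => sizeOf t
decreasing_by all_goals (have h := List.sizeOf_lt_of_mem x.2; simp; omega)

/-- Substitution of the tree `s` for the variable `(n, b)`. -/
def subst (n : ℕ) (b : Bool) (s : Tree) : Tree → Tree
  | var m c => if m = n ∧ c = b then s else var m c
  | unit l => unit l
  | counit l => counit l
  | tens ts => tens (ts.attach.map (fun x => Tree.subst n b s x.1))
  | parr ts => parr (ts.attach.map (fun x => Tree.subst n b s x.1))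
termination_by t => sizeOf t
decreasing_by all_goals (have h := List.sizeOf_lt_of_mem x.2; simp; omega)

/-- Iterated substitution `t[t₁/x̄₁]⋯[tₙ/x̄ₙ]`: each list entry `((n,b), s)`
    records an axiom cut `⟨x|s⟩` with `x = (n,b)`, and `s` is substituted
    for `x̄ = (n, !b)`. -/
def substList (l : List ((ℕ × Bool) × Tree)) (t : Tree) : Tree :=
  l.foldl (fun u e => u.subst e.1.1 (!e.1.2) e.2) t

end Tree

/-- A (bare) proof net with a jump function: a finite set of cuts, a finite
    family of conclusion trees, and a jump function assigning a tree to each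
    counit label. -/
structure Net : Type where
  cuts : Finset (Tree × Tree)
  concl : List Tree
  jump : ℕ → Tree

namespace Net

/-- The subtrees of a net. -/
noncomputable def ST (p : Net) : Finset Tree :=
  (p.cuts.biUnion fun c => c.1.ST ∪ c.2.ST) ∪ (p.concl.map Tree.ST).foldr (· ∪ ·) ∅

/-- The multiset of atoms of a net. -/
def atoms (p : Net) : Multiset Atom :=
  (p.cuts.val.map fun c => c.1.atoms + c.2.atoms).sum + (p.concl.map Tree.atoms).sum

/-- The counit labels occurring in a net. -/
noncomputable def counitLabels (p : Net) : Finset ℕ :=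
  p.ST.biUnion fun t => match t with | Tree.counit l => {l} | _ => ∅

/-- The size of a net: its number of subtrees. -/
def size (p : Net) : ℕ :=
  (p.cuts.sum fun c => c.1.size + c.2.size) + (p.concl.map Tree.size).sum

/-- Well-formedness: each atom occurs at most once, connectives have arity
    ≥ 1, variables are closed under the involution, and jumps of counits
    occurring in the net are subtrees of the net. -/
def IsMLL (p : Net) : Prop :=
  p.atoms.Nodup ∧
  (∀ ts, Tree.tens ts ∈ p.ST → ts ≠ []) ∧
  (∀ ts, Tree.parr ts ∈ p.ST → ts ≠ []) ∧
  (∀ n b, Atom.var n b ∈ p.atoms → Atom.var n (!b) ∈ p.atoms) ∧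
  (∀ m, Tree.counit m ∈ p.ST → p.jump m ∈ p.ST)

end Net

/-- Edges of switching graphs: axiom edges, ⊗-edges (one per premise),
    ⅋-edges (one per ⅋-tree, its other endpoint chosen by the switching),
    jump edges and cut edges. -/
inductive Edge : Type where
  | ax : ℕ → Edge
  | tensE : Tree → Tree → Edge
  | parrE : Tree → Edge
  | jumpE : ℕ → Edge
  | cutE : Tree → Tree → Edge

/-- A switching chooses a premise of each ⅋-subtree. -/
def Net.IsSwitching (p : Net) (I : Tree → Tree) : Prop :=
  ∀ ts, Tree.parr ts ∈ p.ST → I (Tree.parr ts) ∈ ts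

/-- Adjacency in the switching graph of `p` determined by the switching `I`. -/
inductive Net.Adj (p : Net) (I : Tree → Tree) : Edge → Tree → Tree → Prop
  | ax (n : ℕ) : Tree.var n true ∈ p.ST → Tree.var n false ∈ p.ST →
      Net.Adj p I (Edge.ax n) (Tree.var n true) (Tree.var n false)
  | tens {ts t} : Tree.tens ts ∈ p.ST → t ∈ ts →
      Net.Adj p I (Edge.tensE (Tree.tens ts) t) (Tree.tens ts) t
  | parr {ts} : Tree.parr ts ∈ p.ST →
      Net.Adj p I (Edge.parrE (Tree.parr ts)) (Tree.parr ts) (I (Tree.parr ts))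
  | jump {m} : Tree.counit m ∈ p.ST →
      Net.Adj p I (Edge.jumpE m) (Tree.counit m) (p.jump m)
  | cut {t s} : (t, s) ∈ p.cuts → Net.Adj p I (Edge.cutE t s) t s
  | symm {e t u} : Net.Adj p I e t u → Net.Adj p I e u t

/-- `IsTrail p I t l` : `l` is a switching path (a sequence of pairwise
    distinct consecutive edges, each paired with the vertex it reaches)
    starting from the subtree `t`. -/
inductive Net.IsTrail (p : Net) (I : Tree → Tree) : Tree → List (Edge × Tree) → Prop
  | nil (t) : t ∈ p.ST → Net.IsTrail p I t []
  | cons {t e u l} : Net.Adj p I e t u → Net.IsTrail p I u l → (∀ x ∈ l, x.1 ≠ e) →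
      Net.IsTrail p I t ((e, u) :: l)

/-- `ln p` : the maximal length of a switching path of `p`. -/
noncomputable def Net.ln (p : Net) : ℕ :=
  sSup {n | ∃ I t l, p.IsSwitching I ∧ p.IsTrail I t l ∧ l.length = n}

/-- `jd p` : the maximal number of counit labels jumping to a common
    subtree of `p`. -/
noncomputable def Net.jd (p : Net) : ℕ :=
  p.ST.sup fun t => (p.counitLabels.filter fun m => p.jump m = t).card

/-- A net is acyclic when no switching path visits the same subtree twice. -/
def Net.IsAcyclic (p : Net) : Prop :=
  ∀ I, p.IsSwitching I → ∀ t l, p.IsTrail I t l → (t :: l.map Prod.snd).Nodup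

/-! ### Parallel cut elimination -/

/-- Cuts of `p` eliminated by the multiplicative family `F` (given by the
    lists of premises of the ⊗- and ⅋-trees of each cut). -/
noncomputable def melim (F : Finset (List Tree × List Tree)) : Finset (Tree × Tree) :=
  F.biUnion fun c => {(Tree.tens c.1, Tree.parr c.2), (Tree.parr c.2, Tree.tens c.1)}

/-- Residual cuts produced by the multiplicative family `F`. -/
noncomputable def mres (F : Finset (List Tree × List Tree)) : Finset (Tree × Tree) :=
  F.biUnion fun c => (c.1.zip c.2).toFinset

/-- Cuts of `p` eliminated by an axiom family. -/
noncomputable def aelim (la : List ((ℕ × Bool) × Tree)) : Finset (Tree × Tree) :=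
  la.foldr (fun e s =>
    insert (Tree.var e.1.1 e.1.2, e.2) (insert (e.2, Tree.var e.1.1 e.1.2) s)) ∅

/-- Cuts of `p` eliminated by an evanescent family (pairs `(λ, μ)` of a unit
    and a counit label). -/
noncomputable def eelim (le : List (ℕ × ℕ)) : Finset (Tree × Tree) :=
  le.foldr (fun e s =>
    insert (Tree.unit e.1, Tree.counit e.2) (insert (Tree.counit e.2, Tree.unit e.1) s)) ∅

/-- The redirection function `ρ` for the parallel elimination of evanescent
    cuts: `Rho p le j t` holds when the jump of the `j`-th eliminated
    counit, followed along the chain of eliminated evanescent cuts, ends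
    at the tree `t`. -/
inductive Rho (p : Net) (le : List (ℕ × ℕ)) : ℕ → Tree → Prop
  | base (j : ℕ) :
      (∀ i < j, p.jump ((le.getD j (0,0)).2) ≠ Tree.counit ((le.getD i (0,0)).2) ∧
                p.jump ((le.getD j (0,0)).2) ≠ Tree.unit ((le.getD i (0,0)).1)) →
      Rho p le j (p.jump ((le.getD j (0,0)).2))
  | step {i j : ℕ} {t : Tree} : i < j →
      (p.jump ((le.getD j (0,0)).2) = Tree.counit ((le.getD i (0,0)).2) ∨
       p.jump ((le.getD j (0,0)).2) = Tree.unit ((le.getD i (0,0)).1)) →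
      Rho p le i t → Rho p le j t

/-- `ParStepF p q F la le` : `q` is obtained from `p` by the simultaneous
    elimination of the family `F` of multiplicative cuts, the family `la` of
    axiom cuts and the family `le` of evanescent cuts. -/
structure ParStepF (p q : Net) (F : Finset (List Tree × List Tree))
    (la : List ((ℕ × Bool) × Tree)) (le : List (ℕ × ℕ)) : Prop where
  /-- each member of `F` is a multiplicative cut of `p` -/
  hF : ∀ c ∈ F, c.1.length = c.2.length ∧ c.1 ≠ [] ∧
       ((Tree.tens c.1, Tree.parr c.2) ∈ p.cuts ∨ (Tree.parr c.2, Tree.tens c.1) ∈ p.cuts)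
  /-- each member of `la` is an axiom cut of `p` -/
  ha : ∀ e ∈ la, (Tree.var e.1.1 e.1.2, e.2) ∈ p.cuts ∨ (e.2, Tree.var e.1.1 e.1.2) ∈ p.cuts
  haN : (la.map Prod.fst).Nodup
  /-- `x̄ᵢ ∉ {x₁, …, xₙ}` -/
  haBar : ∀ e ∈ la, (e.1.1, !e.1.2) ∉ la.map Prod.fst
  /-- `x̄ᵢ` does not occur in `tⱼ` for `i ≤ j` -/
  haFv : ∀ i j, i ≤ j → j < la.length →
      Atom.var (la.getD i default).1.1 (!(la.getD i default).1.2) ∉ (la.getD j default).2.atoms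
  /-- each member of `le` is a cut of `p` between a unit and a counit -/
  he : ∀ e ∈ le, (Tree.unit e.1, Tree.counit e.2) ∈ p.cuts ∨ (Tree.counit e.2, Tree.unit e.1) ∈ p.cuts
  heN : (le.map Prod.snd).Nodup
  /-- `jump(μᵢ) ∉ {⊥_{μⱼ}, 1_{λⱼ}}` for `i ≤ j` (in particular each eliminated
      evanescent cut is reducible) -/
  heJ : ∀ i j, i ≤ j → j < le.length →
      p.jump ((le.getD i (0,0)).2) ≠ Tree.counit ((le.getD j (0,0)).2) ∧
      p.jump ((le.getD i (0,0)).2) ≠ Tree.unit ((le.getD j (0,0)).1)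
  /-- the cuts of `q`: the remaining cuts plus the multiplicative residuals,
      under the substitution generated by the axiom cuts -/
  hcuts : q.cuts = ((p.cuts \ (melim F ∪ aelim la ∪ eelim le)) ∪ mres F).image
      (fun c => (Tree.substList la c.1, Tree.substList la c.2))
  /-- the conclusions of `q` -/
  hconcl : q.concl = p.concl.map (Tree.substList la)
  /-- the jump function of `q`, with redirections -/
  hjump : ∀ m, Tree.counit m ∈ q.ST →
      (∃ c ∈ F, p.jump m = Tree.tens c.1 ∧ q.jump m = Tree.substList la c.1.headI) ∨
      (∃ c ∈ F, p.jump m = Tree.parr c.2 ∧ q.jump m = Tree.substList la c.2.headI) ∨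
      (∃ i < la.length,
        (p.jump m = Tree.var (la.getD i default).1.1 (la.getD i default).1.2 ∨
         p.jump m = Tree.var (la.getD i default).1.1 (!(la.getD i default).1.2)) ∧
        q.jump m = Tree.substList (la.drop (i+1)) (la.getD i default).2) ∨
      (∃ i < le.length,
        (p.jump m = Tree.counit ((le.getD i (0,0)).2) ∨
         p.jump m = Tree.unit ((le.getD i (0,0)).1)) ∧
        ∃ t, Rho p le i t ∧ q.jump m = Tree.substList la t) ∨
      ((∀ c ∈ F, p.jump m ≠ Tree.tens c.1 ∧ p.jump m ≠ Tree.parr c.2) ∧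
       (∀ e ∈ la, p.jump m ≠ Tree.var e.1.1 e.1.2 ∧ p.jump m ≠ Tree.var e.1.1 (!e.1.2)) ∧
       (∀ e ∈ le, p.jump m ≠ Tree.counit e.2 ∧ p.jump m ≠ Tree.unit e.1) ∧
       q.jump m = Tree.substList la (p.jump m))

/-- Parallel elimination of a family of multiplicative cuts (`p ⇒m q`). -/
def MultStep (p q : Net) : Prop := ∃ F, ParStepF p q F [] []

/-- Parallel elimination of a family of axiom cuts (`p ⇒a q`). -/
def AxStep (p q : Net) : Prop := ∃ la, ParStepF p q ∅ la []

/-- Parallel elimination of a family of evanescent cuts (`p ⇒e q`). -/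
def EvStep (p q : Net) : Prop := ∃ le, ParStepF p q ∅ [] le

/-- A parallel cut elimination step (`p ⇒ q`), eliminating an arbitrary
    family of reducible cuts of the three kinds. -/
def ParStep (p q : Net) : Prop := ∃ F la le, ParStepF p q F la le

/-- Elimination of a single reducible cut. -/
def Step1 (p q : Net) : Prop :=
  (∃ c, ParStepF p q {c} [] []) ∨ (∃ e, ParStepF p q ∅ [e] []) ∨ (∃ e, ParStepF p q ∅ [] [e])

/-- `k` parallel cut elimination steps. -/
def ParStepN : ℕ → Net → Net → Prop
  | 0, p, q => p = q
  | k+1, p, q => ∃ r, ParStep p r ∧ ParStepN k r q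

/-! ### Evanescent cuts and the sets `Iⁿ(t)` -/

/-- `p.IsEvCut l m` : `⟨1_l | ⊥_m⟩` is a reducible evanescent cut of `p`. -/
def Net.IsEvCut (p : Net) (l m : ℕ) : Prop :=
  ((Tree.unit l, Tree.counit m) ∈ p.cuts ∨ (Tree.counit m, Tree.unit l) ∈ p.cuts) ∧
  p.jump m ≠ Tree.unit l ∧ p.jump m ≠ Tree.counit m

/-- The sets `Iⁿ(t)` of counit labels reaching `t` through a chain of `n`
    evanescent cuts. -/
noncomputable def Net.Iset (p : Net) (t : Tree) : ℕ → Finset ℕ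
  | 0 => p.counitLabels.filter fun m => p.jump m = t
  | n+1 => p.counitLabels.filter fun m' =>
      ∃ l m, p.IsEvCut l m ∧ m ∈ p.Iset t n ∧
        (p.jump m' = Tree.counit m ∨ p.jump m' = Tree.unit l)

/-- The number of evanescent cuts of `p`. -/
noncomputable def Net.evCutCount (p : Net) : ℕ :=
  (p.cuts.filter fun c => ∃ l m,
    (c = (Tree.unit l, Tree.counit m) ∨ c = (Tree.counit m, Tree.unit l)) ∧
    p.jump m ≠ Tree.unit l ∧ p.jump m ≠ Tree.counit m).card

/-! ### The function φ -/

/-- `φ(0) = 0` and `φ(n) = n + (n+1)(φ(n-1)+2)` for `n > 0`. -/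
def phi : ℕ → ℕ
  | 0 => 0
  | n + 1 => (n + 1) + (n + 2) * (phi n + 2)

/-! ### Residual edges, slipknots, bridges and bounces -/

/-- The residual cut edges in `q` of an eliminated multiplicative cut. -/
noncomputable def resEdges (c : List Tree × List Tree) : Finset Edge :=
  ((c.1.zip c.2).map fun d => Edge.cutE d.1 d.2).toFinset

/-- Canonical form of a `c`-bridge: a path bound to `c` crossing its cut edge. -/
def IsBridgeCan (c : List Tree × List Tree) (b : List Edge) : Prop :=
  ∃ pre post : List Edge,
    (pre = [] ∨ ∃ t ∈ c.1, pre = [Edge.tensE (Tree.tens c.1) t]) ∧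
    (post = [] ∨ post = [Edge.parrE (Tree.parr c.2)]) ∧
    (b = pre ++ Edge.cutE (Tree.tens c.1) (Tree.parr c.2) :: post ∨
     b = pre ++ Edge.cutE (Tree.parr c.2) (Tree.tens c.1) :: post)

/-- A `c`-bridge, in either direction. -/
def IsBridge (c : List Tree × List Tree) (b : List Edge) : Prop :=
  IsBridgeCan c b ∨ IsBridgeCan c b.reverse

/-- A `c`-bounce: a path bound to `c`, not crossing its cut edge, and
    visiting its ⊗-tree. -/
def IsBounce (c : List Tree × List Tree) (b : List Edge) : Prop :=
  b = [] ∨ (∃ t ∈ c.1, b = [Edge.tensE (Tree.tens c.1) t]) ∨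
  (∃ t ∈ c.1, ∃ t' ∈ c.1, t ≠ t' ∧
    b = [Edge.tensE (Tree.tens c.1) t, Edge.tensE (Tree.tens c.1) t'])

/-- `Gen F es es'` : the edge sequence `es'` (in `p`) is generated by the
    straight edge sequence `es` (in `q`): preserved edges are kept, and each
    residual cut edge is replaced by a bridge of the corresponding
    eliminated cut. -/
inductive Gen (F : Finset (List Tree × List Tree)) : List Edge → List Edge → Prop
  | nil : Gen F [] []
  | pres {e l l'} : (∀ c ∈ F, e ∉ resEdges c) → Gen F l l' → Gen F (e :: l) (e :: l')
  | res {c d l l' b} : c ∈ F → d ∈ resEdges c → IsBridge c b → Gen F l l' →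
      Gen F (d :: l) (b ++ l')

/-- A straight path: a path with no slipknot, i.e. crossing at most one
    residual of each eliminated cut. -/
def Straight (F : Finset (List Tree × List Tree)) (l : List (Edge × Tree)) : Prop :=
  ¬ ∃ c ∈ F, ∃ l₁ l₂ l₃ : List (Edge × Tree), ∃ d v d' v',
      d ∈ resEdges c ∧ d' ∈ resEdges c ∧ l = l₁ ++ (d, v) :: l₂ ++ (d', v') :: l₃

/-- Independent paths: disjoint, and crossing residuals of no common
    eliminated cut. -/
def Indep (F : Finset (List Tree × List Tree)) (l₁ l₂ : List (Edge × Tree)) : Prop :=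
  (∀ x ∈ l₁, ∀ y ∈ l₂, x.1 ≠ y.1) ∧
  ¬ ∃ c ∈ F, (∃ x ∈ l₁, x.1 ∈ resEdges c) ∧ (∃ y ∈ l₂, y.1 ∈ resEdges c)

/-- `DecompWith F l cs χs ξs` : the decomposition `l = χ₁ξ₁⋯χₙξₙχₙ₊₁` of a
    path of `q` into pairwise independent straight paths `χᵢ` and slipknots
    `ξᵢ` on the pairwise distinct eliminated cuts `cs = c₁, …, cₙ`. -/
def DecompWith (F : Finset (List Tree × List Tree)) (l : List (Edge × Tree))
    (cs : List (List Tree × List Tree)) (χs ξs : List (List (Edge × Tree))) : Prop :=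
  cs.Nodup ∧ (∀ c ∈ cs, c ∈ F) ∧
  χs.length = cs.length + 1 ∧ ξs.length = cs.length ∧
  l = (List.zipWith (· ++ ·) χs (ξs ++ [[]])).flatten ∧
  (∀ x ∈ χs, Straight F x ∧ ∀ c ∈ cs, ∀ y ∈ x, y.1 ∉ resEdges c) ∧
  χs.Pairwise (Indep F) ∧
  List.Forall₂ (fun (ξ : List (Edge × Tree)) (c : List Tree × List Tree) =>
      ∃ t s t' s' mid, (t, s) ∈ c.1.zip c.2 ∧ (t', s') ∈ c.1.zip c.2 ∧ t ≠ t' ∧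
        ξ = (Edge.cutE t s, s) :: mid ++ [(Edge.cutE t' s', t')]) ξs cs

/-- `Decomp F l cs` : some decomposition of `l` along the cut sequence `cs`
    exists. -/
def Decomp (F : Finset (List Tree × List Tree)) (l : List (Edge × Tree))
    (cs : List (List Tree × List Tree)) : Prop :=
  ∃ χs ξs, DecompWith F l cs χs ξs

/-! ### α-equivalence -/

/-- A renaming of atoms: a map on variable names together with a possible
    flip of polarities (so as to commute with the involution), a map on unit
    labels and a map on counit labels. -/
structure Ren : Type where
  v : ℕ → ℕ
  vb : ℕ → Bool
  u : ℕ → ℕ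
  c : ℕ → ℕ

/-- Applying a renaming to a tree. -/
def Tree.rename (r : Ren) : Tree → Tree
  | Tree.var n b => Tree.var (r.v n) (xor b (r.vb n))
  | Tree.unit l => Tree.unit (r.u l)
  | Tree.counit l => Tree.counit (r.c l)
  | Tree.tens ts => Tree.tens (ts.attach.map (fun x => Tree.rename r x.1))
  | Tree.parr ts => Tree.parr (ts.attach.map (fun x => Tree.rename r x.1))
termination_by t => sizeOf t
decreasing_by all_goals (have h := List.sizeOf_lt_of_mem x.2; simp; omega)

/-- α-equivalence of nets: renaming of atoms (preserving the involution on
    variables) and reindexing of cuts. -/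
def AlphaEq (p q : Net) : Prop :=
  ∃ r : Ren, Function.Bijective r.v ∧ Function.Bijective r.u ∧ Function.Bijective r.c ∧
    q.cuts = p.cuts.image (fun c => (c.1.rename r, c.2.rename r)) ∧
    q.concl = p.concl.map (Tree.rename r) ∧
    (∀ m, Tree.counit m ∈ p.ST → q.jump (r.c m) = (p.jump m).rename r)

end MLLNets

namespace MLLNets

section EvanescentJumps

attribute [local instance] Classical.propDecidable

theorem mem_foldr_union {α β : Type*} [DecidableEq β] (f : α → Finset β) (l : List α) (x : β) :
    x ∈ (l.map f).foldr (· ∪ ·) ∅ ↔ ∃ a ∈ l, x ∈ f a := by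
  induction l with
  | nil => simp
  | cons a l ih => simp [ih]

theorem Tree.mem_ST_tens (ts : List Tree) (x : Tree) :
    x ∈ (Tree.tens ts).ST ↔ x = Tree.tens ts ∨ ∃ u ∈ ts, x ∈ u.ST := by
  rw [Tree.ST, Finset.mem_insert, mem_foldr_union]
  simp

theorem Tree.mem_ST_parr (ts : List Tree) (x : Tree) :
    x ∈ (Tree.parr ts).ST ↔ x = Tree.parr ts ∨ ∃ u ∈ ts, x ∈ u.ST := by
  rw [Tree.ST, Finset.mem_insert, mem_foldr_union]
  simp

theorem Tree.self_mem_ST (t : Tree) : t ∈ t.ST := by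
  cases t with
  | tens ts => simp [Tree.mem_ST_tens]
  | parr ts => simp [Tree.mem_ST_parr]
  | _ => simp [Tree.ST]

/-- Premises of a subtree are subtrees. -/
theorem Tree.premise_mem_ST {ts : List Tree} {u : Tree} (hu : u ∈ ts) :
    ∀ t : Tree, (Tree.tens ts ∈ t.ST ∨ Tree.parr ts ∈ t.ST) → u ∈ t.ST
  | .var n b, h => by simp [Tree.ST] at h
  | .unit l, h => by simp [Tree.ST] at h
  | .counit l, h => by simp [Tree.ST] at h
  | .tens us, h => by
    simp only [Tree.mem_ST_tens, Tree.tens.injEq, reduceCtorEq, false_or] at h ⊢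
    rcases h with (rfl | ⟨v, hv, h⟩) | ⟨v, hv, h⟩
    · exact Or.inr ⟨u, hu, u.self_mem_ST⟩
    · exact Or.inr ⟨v, hv, Tree.premise_mem_ST hu v (Or.inl h)⟩
    · exact Or.inr ⟨v, hv, Tree.premise_mem_ST hu v (Or.inr h)⟩
  | .parr us, h => by
    simp only [Tree.mem_ST_parr, Tree.parr.injEq, reduceCtorEq, false_or] at h ⊢
    rcases h with ⟨v, hv, h⟩ | rfl | ⟨v, hv, h⟩
    · exact Or.inr ⟨v, hv, Tree.premise_mem_ST hu v (Or.inl h)⟩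
    · exact Or.inr ⟨u, hu, u.self_mem_ST⟩
    · exact Or.inr ⟨v, hv, Tree.premise_mem_ST hu v (Or.inr h)⟩
termination_by t => sizeOf t
decreasing_by all_goals (have := List.sizeOf_lt_of_mem hv; simp; omega)

namespace Net

theorem mem_ST (p : Net) (x : Tree) :
    x ∈ p.ST ↔ (∃ c ∈ p.cuts, x ∈ c.1.ST ∨ x ∈ c.2.ST) ∨ ∃ t ∈ p.concl, x ∈ t.ST := by
  rw [ST, Finset.mem_union, mem_foldr_union]
  simp only [Finset.mem_biUnion, Finset.mem_union]

theorem mem_counitLabels (p : Net) (m : ℕ) : m ∈ p.counitLabels ↔ Tree.counit m ∈ p.ST := by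
  simp only [counitLabels, Finset.mem_biUnion]
  constructor
  · rintro ⟨t, ht, hm⟩
    cases t <;> simp at hm
    subst hm
    exact ht
  · intro h
    exact ⟨_, h, by simp⟩

theorem premise_mem_ST {p : Net} {ts : List Tree} {u : Tree} (hu : u ∈ ts)
    (h : Tree.tens ts ∈ p.ST ∨ Tree.parr ts ∈ p.ST) : u ∈ p.ST := by
  simp only [mem_ST] at h ⊢
  rcases h with (⟨c, hc, h | h⟩ | ⟨t, ht, h⟩) | (⟨c, hc, h | h⟩ | ⟨t, ht, h⟩)
  · exact Or.inl ⟨c, hc, Or.inl (Tree.premise_mem_ST hu _ (Or.inl h))⟩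
  · exact Or.inl ⟨c, hc, Or.inr (Tree.premise_mem_ST hu _ (Or.inl h))⟩
  · exact Or.inr ⟨t, ht, Tree.premise_mem_ST hu _ (Or.inl h)⟩
  · exact Or.inl ⟨c, hc, Or.inl (Tree.premise_mem_ST hu _ (Or.inr h))⟩
  · exact Or.inl ⟨c, hc, Or.inr (Tree.premise_mem_ST hu _ (Or.inr h))⟩
  · exact Or.inr ⟨t, ht, Tree.premise_mem_ST hu _ (Or.inr h)⟩

theorem cut_mem_ST {p : Net} {t s : Tree} (h : (t, s) ∈ p.cuts) : t ∈ p.ST ∧ s ∈ p.ST := by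
  simp only [mem_ST]
  exact ⟨Or.inl ⟨_, h, Or.inl t.self_mem_ST⟩, Or.inl ⟨_, h, Or.inr s.self_mem_ST⟩⟩

theorem Adj.mem_ST {p : Net} (hp : p.IsMLL) {I : Tree → Tree} (hI : p.IsSwitching I)
    {e : Edge} {t u : Tree} (h : p.Adj I e t u) : t ∈ p.ST ∧ u ∈ p.ST := by
  induction h with
  | ax n h₁ h₂ => exact ⟨h₁, h₂⟩
  | tens h ht => exact ⟨h, premise_mem_ST ht (Or.inl h)⟩
  | parr h => exact ⟨h, premise_mem_ST (hI _ h) (Or.inr h)⟩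
  | jump h => exact ⟨h, hp.2.2.2.2 _ h⟩
  | cut h => exact cut_mem_ST h
  | symm _ ih => exact ih.symm

theorem IsTrail.mem_ST {p : Net} (hp : p.IsMLL) {I : Tree → Tree} (hI : p.IsSwitching I)
    {t : Tree} {l : List (Edge × Tree)} (h : p.IsTrail I t l) :
    ∀ x ∈ t :: l.map Prod.snd, x ∈ p.ST := by
  induction h with
  | nil t ht => simpa using ht
  | cons ha _ _ ih =>
    intro x hx
    rw [List.mem_cons] at hx
    rcases hx with rfl | hx
    · exact (ha.mem_ST hp hI).1
    · exact ih x hx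

/-- In an acyclic net, `ln p` bounds the length of every switching path. -/
theorem IsTrail.length_le_ln {p : Net} (hp : p.IsMLL) (hpa : p.IsAcyclic) {I : Tree → Tree}
    (hI : p.IsSwitching I) {t : Tree} {l : List (Edge × Tree)} (h : p.IsTrail I t l) :
    l.length ≤ p.ln := by
  refine le_csSup ⟨p.ST.card, ?_⟩ ⟨I, t, l, hI, h, rfl⟩
  rintro n ⟨I, t, l, hI, h, rfl⟩
  have h₁ : (t :: l.map Prod.snd).toFinset ⊆ p.ST := fun x hx =>
    h.mem_ST hp hI x (List.mem_toFinset.1 hx)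
  have h₂ := Finset.card_le_card h₁
  rw [List.toFinset_card_of_nodup (hpa I hI t l h)] at h₂
  simp at h₂
  omega

theorem IsMLL.exists_isSwitching {p : Net} (hp : p.IsMLL) : ∃ I, p.IsSwitching I := by
  refine ⟨fun t => match t with | Tree.parr ts => ts.headI | t => t, fun ts h => ?_⟩
  have := hp.2.2.1 ts h
  cases ts with
  | nil => exact absurd rfl this
  | cons a l => simp

theorem card_jump_le_jd (p : Net) (hp : p.IsMLL) (t : Tree) :
    (p.counitLabels.filter fun m => p.jump m = t).card ≤ p.jd := by
  by_cases ht : t ∈ p.ST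
  · exact Finset.le_sup (f := fun t => (p.counitLabels.filter fun m => p.jump m = t).card) ht
  · rw [Finset.filter_false_of_mem]
    · simp
    · rintro m hm rfl
      exact ht (hp.2.2.2.2 m ((p.mem_counitLabels m).1 hm))

/-- The counit labels reaching `t` through a chain of `n` of the evanescent cuts `le`. -/
noncomputable def chainSet (p : Net) (le : List (ℕ × ℕ)) (t : Tree) : ℕ → Finset ℕ
  | 0 => p.counitLabels.filter fun m => p.jump m = t
  | n + 1 => p.counitLabels.filter fun m => ∃ e ∈ le, e.2 ∈ p.chainSet le t n ∧
      (p.jump m = Tree.counit e.2 ∨ p.jump m = Tree.unit e.1)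

theorem card_chainSet_le (p : Net) (hp : p.IsMLL) {le : List (ℕ × ℕ)}
    (hle : (le.map Prod.snd).Nodup) (t : Tree) (n : ℕ) :
    (p.chainSet le t n).card ≤ p.jd * (2 * p.jd) ^ n := by
  induction n with
  | zero => simpa [chainSet] using p.card_jump_le_jd hp t
  | succ n ih =>
    set E := le.toFinset.filter fun e => e.2 ∈ p.chainSet le t n with hE
    have hsub : p.chainSet le t (n + 1) ⊆ E.biUnion fun e =>
        (p.counitLabels.filter fun m => p.jump m = Tree.counit e.2) ∪
        (p.counitLabels.filter fun m => p.jump m = Tree.unit e.1) := by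
      intro m hm
      simp only [chainSet, Finset.mem_filter] at hm
      obtain ⟨hm, e, he, hen, hj⟩ := hm
      simp only [Finset.mem_biUnion, Finset.mem_union, Finset.mem_filter, hE, List.mem_toFinset]
      exact ⟨e, ⟨he, hen⟩, hj.imp (⟨hm, ·⟩) (⟨hm, ·⟩)⟩
    have hcard : E.card ≤ (p.chainSet le t n).card := by
      refine Finset.card_le_card_of_injOn Prod.snd ?_ ?_
      · intro e he
        exact (Finset.mem_filter.1 he).2
      · intro a ha b hb hab
        exact List.inj_on_of_nodup_map hle (List.mem_toFinset.1 (Finset.mem_filter.1 ha).1)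
          (List.mem_toFinset.1 (Finset.mem_filter.1 hb).1) hab
    calc (p.chainSet le t (n + 1)).card
        ≤ E.card * (2 * p.jd) := by
          refine (Finset.card_le_card hsub).trans (Finset.card_biUnion_le_card_mul _ _ _ ?_)
          intro e _
          refine (Finset.card_union_le _ _).trans ?_
          have h₁ := p.card_jump_le_jd hp (Tree.counit e.2)
          have h₂ := p.card_jump_le_jd hp (Tree.unit e.1)
          omega
      _ ≤ p.jd * (2 * p.jd) ^ n * (2 * p.jd) := Nat.mul_le_mul_right _ (hcard.trans ih)
      _ = p.jd * (2 * p.jd) ^ (n + 1) := by ring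

end Net

/-- Following the redirections from the `j`-th eliminated counit yields a switching path at least
as long as the chain of eliminated cuts it goes through. -/
theorem Rho.exists_trail {p : Net} (hp : p.IsMLL) {I : Tree → Tree} {le : List (ℕ × ℕ)}
    (hle : (le.map Prod.snd).Nodup)
    (hcut : ∀ e ∈ le, (Tree.unit e.1, Tree.counit e.2) ∈ p.cuts ∨
      (Tree.counit e.2, Tree.unit e.1) ∈ p.cuts)
    {j : ℕ} {t : Tree} (h : Rho p le j t) (hj : j < le.length) :
    ∃ n l, (le.getD j (0, 0)).2 ∈ p.chainSet le t n ∧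
      p.IsTrail I (Tree.counit (le.getD j (0, 0)).2) l ∧ n + 1 ≤ l.length ∧
      ∀ x ∈ l, (∃ k ≤ j, x.1 = Edge.jumpE (le.getD k (0, 0)).2) ∨
        ∃ k < j, x.1 = Edge.cutE (Tree.unit (le.getD k (0, 0)).1)
            (Tree.counit (le.getD k (0, 0)).2) ∨
          x.1 = Edge.cutE (Tree.counit (le.getD k (0, 0)).2)
            (Tree.unit (le.getD k (0, 0)).1) := by
  have hmem : ∀ i < le.length, le.getD i (0, 0) ∈ le := fun i hi => by
    rw [List.getD_eq_getElem _ _ hi]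
    exact List.getElem_mem hi
  have hinj : ∀ i k, i < k → k < le.length →
      (le.getD i (0, 0)).2 ≠ (le.getD k (0, 0)).2 := by
    intro i k hik hk heq
    rw [List.getD_eq_getElem _ _ hk, List.getD_eq_getElem _ _ (hik.trans hk)] at heq
    have := (hle.getElem_inj_iff (i := i) (j := k) (hi := by simp; omega)
      (hj := by simpa using hk)).1 (by simpa using heq)
    omega
  have hST : ∀ i < le.length, Tree.counit (le.getD i (0, 0)).2 ∈ p.ST := fun i hi =>
    (hcut _ (hmem i hi)).elim (fun h => (Net.cut_mem_ST h).2) (fun h => (Net.cut_mem_ST h).1)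
  induction h with
  | base j _ =>
    refine ⟨0, [(Edge.jumpE (le.getD j (0, 0)).2, p.jump (le.getD j (0, 0)).2)], ?_, ?_, ?_, ?_⟩
    · simpa [Net.chainSet, Net.mem_counitLabels] using hST j hj
    · exact .cons (.jump (hST j hj)) (.nil _ (hp.2.2.2.2 _ (hST j hj))) (by simp)
    · simp
    · intro x hx
      rw [List.mem_singleton] at hx
      subst hx
      exact Or.inl ⟨j, le_rfl, rfl⟩
  | @step i j t hij hjump _ ih =>
    have hi := hij.trans hj
    obtain ⟨n, l, hn, hl, hlen, hedge⟩ := ih hi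
    have hchain : (le.getD j (0, 0)).2 ∈ p.chainSet le t (n + 1) := by
      rw [Net.chainSet, Finset.mem_filter, Net.mem_counitLabels]
      exact ⟨hST j hj, _, hmem i hi, hn, hjump⟩
    have hjne : ∀ x ∈ l, x.1 ≠ Edge.jumpE (le.getD j (0, 0)).2 := by
      intro x hx heq
      rcases hedge x hx with ⟨k, hk, h⟩ | ⟨k, hk, h | h⟩
      · rw [heq, Edge.jumpE.injEq] at h
        exact hinj k j (by omega) hj h.symm
      · rw [heq] at h; cases h
      · rw [heq] at h; cases h
    have hjadj := Net.Adj.jump (I := I) (hST j hj)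
    have hjumpEdge : ∀ x ∈ l, (∃ k ≤ j, x.1 = Edge.jumpE (le.getD k (0, 0)).2) ∨
        ∃ k < j, x.1 = Edge.cutE (Tree.unit (le.getD k (0, 0)).1)
            (Tree.counit (le.getD k (0, 0)).2) ∨
          x.1 = Edge.cutE (Tree.counit (le.getD k (0, 0)).2)
            (Tree.unit (le.getD k (0, 0)).1) := fun x hx =>
      (hedge x hx).imp (fun ⟨k, hk, h⟩ => ⟨k, by omega, h⟩) (fun ⟨k, hk, h⟩ => ⟨k, by omega, h⟩)
    rcases hjump with hc | hu
    · rw [hc] at hjadj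
      refine ⟨n + 1, _ :: l, hchain, .cons hjadj hl hjne, by simpa using hlen, ?_⟩
      intro x hx
      rcases List.mem_cons.1 hx with rfl | hx
      · exact Or.inl ⟨j, le_rfl, rfl⟩
      · exact hjumpEdge x hx
    · rw [hu] at hjadj
      obtain ⟨e, he, hadj⟩ : ∃ e, (e = Edge.cutE (Tree.unit (le.getD i (0, 0)).1)
            (Tree.counit (le.getD i (0, 0)).2) ∨
          e = Edge.cutE (Tree.counit (le.getD i (0, 0)).2)
            (Tree.unit (le.getD i (0, 0)).1)) ∧
          p.Adj I e (Tree.unit (le.getD i (0, 0)).1) (Tree.counit (le.getD i (0, 0)).2) :=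
        (hcut _ (hmem i hi)).elim (fun h => ⟨_, Or.inl rfl, .cut h⟩)
          (fun h => ⟨_, Or.inr rfl, .symm (.cut h)⟩)
      have hne : ∀ x ∈ l, x.1 ≠ e := by
        intro x hx heq
        rcases hedge x hx with ⟨k, hk, h⟩ | ⟨k, hk, h⟩
        · rw [heq] at h
          rcases he with rfl | rfl <;> cases h
        · have := hinj k i hk hi
          rw [heq] at h
          rcases he with rfl | rfl <;>
            simp only [Edge.cutE.injEq, Tree.unit.injEq, Tree.counit.injEq, reduceCtorEq,
              false_and, or_false, false_or] at h <;> omega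
      refine ⟨n + 1, _ :: _ :: l, hchain, .cons hjadj (.cons hadj hl hne) ?_,
        by simp only [List.length_cons]; omega, ?_⟩
      · intro x hx
        rcases List.mem_cons.1 hx with rfl | hx
        · rcases he with rfl | rfl <;> simp
        · exact hjne x hx
      · intro x hx
        rcases List.mem_cons.1 hx with rfl | hx
        · exact Or.inl ⟨j, le_rfl, rfl⟩
        · rcases List.mem_cons.1 hx with rfl | hx
          · exact Or.inr ⟨i, hij, he⟩
          · exact hjumpEdge x hx

theorem ParStepF.ST_subset_of_evanescent {p q : Net} {le : List (ℕ × ℕ)}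
    (h : ParStepF p q ∅ [] le) : q.ST ⊆ p.ST := by
  have hs : ∀ t, Tree.substList [] t = t := fun _ => rfl
  intro x hx
  rw [Net.mem_ST] at hx ⊢
  rw [h.hcuts, h.hconcl] at hx
  rcases hx with ⟨c, hc, hx⟩ | ⟨t, ht, hx⟩
  · simp only [hs, mres, Finset.biUnion_empty, Finset.union_empty, Prod.mk.eta, Finset.mem_image,
      exists_eq_right, Finset.mem_sdiff] at hc
    exact Or.inl ⟨c, hc.1, hx⟩
  · simp only [List.mem_map, hs, exists_eq_right] at ht
    exact Or.inr ⟨t, ht, hx⟩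

/-- A counit jumping to `t` after an evanescent step reaches `t` through a chain of at most `ln p`
eliminated cuts. -/
theorem ParStepF.mem_chainSet_of_jump_eq {p q : Net} (hp : p.IsMLL) (hpa : p.IsAcyclic)
    {le : List (ℕ × ℕ)} (h : ParStepF p q ∅ [] le) {m : ℕ} (hm : Tree.counit m ∈ q.ST) :
    ∃ n ≤ p.ln, m ∈ p.chainSet le (q.jump m) n := by
  have hmp := (p.mem_counitLabels m).2 (h.ST_subset_of_evanescent hm)
  rcases h.hjump m hm with ⟨c, hc, -⟩ | ⟨c, hc, -⟩ | ⟨i, hi, -⟩ | ⟨i, hi, hj, t, hr, ht⟩ |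
    ⟨-, -, -, hj⟩
  · simp at hc
  · simp at hc
  · simp at hi
  · obtain ⟨I, hI⟩ := hp.exists_isSwitching
    obtain ⟨n, l, hn, hl, hlen, -⟩ := hr.exists_trail (I := I) hp h.heN h.he hi
    refine ⟨n + 1, hlen.trans (hl.length_le_ln hp hpa hI), ?_⟩
    have ht : q.jump m = t := ht
    rw [Net.chainSet, Finset.mem_filter, ht]
    refine ⟨hmp, _, ?_, hn, hj⟩
    rw [List.getD_eq_getElem _ _ hi]
    exact List.getElem_mem hi
  · have hj : q.jump m = p.jump m := hj
    exact ⟨0, Nat.zero_le _, by simp [Net.chainSet, hmp, hj]⟩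

theorem sum_range_mul_two_mul_pow_le (a n : ℕ) :
    ∑ i ∈ Finset.range n, a * (2 * a) ^ i ≤ (2 * a) ^ n := by
  induction n with
  | zero => simp
  | succ n ih =>
    rw [Finset.sum_range_succ]
    rcases Nat.eq_zero_or_pos a with rfl | ha
    · simp
    · have := Nat.mul_le_mul_right ((2 * a) ^ n) ha
      rw [pow_succ]
      nlinarith

end EvanescentJumps

/-- If `p` and `q` are acyclic MLL proof nets and
    `p ⇒e q`, then `jd(q) ≤ (2·jd(p))^(ln(p)+1)`. -/
theorem ev_jd_bound (p q : Net)
    (hp : p.IsMLL) (hq : q.IsMLL) (hpa : p.IsAcyclic) (hqa : q.IsAcyclic)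
    (h : EvStep p q) :
    q.jd ≤ (2 * p.jd) ^ (p.ln + 1) := by
  classical
  obtain ⟨le, h⟩ := h
  refine Finset.sup_le fun t _ => ?_
  refine le_trans (Finset.card_le_card (t := (Finset.range (p.ln + 1)).biUnion (p.chainSet le t))
    fun m hm => ?_) (Finset.card_biUnion_le.trans ((Finset.sum_le_sum fun n _ =>
      p.card_chainSet_le hp h.heN t n).trans (sum_range_mul_two_mul_pow_le _ _)))
  rw [Finset.mem_filter, Net.mem_counitLabels] at hm
  obtain ⟨hm, rfl⟩ := hm
  obtain ⟨n, hn, hmem⟩ := h.mem_chainSet_of_jump_eq hp hpa hm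
  exact Finset.mem_biUnion.2 ⟨n, Finset.mem_range.2 (by omega), hmem⟩

end MLLNets
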